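/- The set B = {φ₁+2φ₂+2φ₃, φ₁+φ₂+2φ₃+2φ₄, −(φ₁+φ₂+2φ₃+φ₄), φ₃} is a base of Δ, and the positive system determined by B equals Δ_k⁺ ∪ {β ∈ Δ_n⁺ : β ≥ φ₁+2φ₂+2φ₃ or β ≥ φ₁+φ₂+2φ₃+2φ₄} ∪ (−{β ∈ Δ_n⁺ : β ≤ φ₁+φ₂+2φ₃+φ₄}); in particular this positive system contains Δ_k⁺. -/

import Mathlib

noncomputable section

abbrev V : Type := Fin 4 → ℝ

def e (i : Fin 4) : V := Pi.single i 1

/-- The root system of type F₄ in ℝ⁴ (48 vectors). -/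
def Δ : Set V :=
  (⋃ i, ({e i, -e i} : Set V)) ∪
  (⋃ (i) (j) (_ : i < j), ({e i + e j, e i - e j, -e i + e j, -e i - e j} : Set V)) ∪
  {v | ∃ s : Fin 4 → ℝ, (∀ i, s i = 1 ∨ s i = -1) ∧ v = (1 / 2 : ℝ) • ∑ i, s i • e i}

def φ₁ : V := e 1 - e 2
def φ₂ : V := e 2 - e 3
def φ₃ : V := e 3
def φ₄ : V := (1 / 2 : ℝ) • (e 0 - e 1 - e 2 - e 3)

def φv : Fin 4 → V := ![φ₁, φ₂, φ₃, φ₄]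

/-- The coordinates `n₁(α), …, n₄(α)` of `α` with respect to the basis φ₁,…,φ₄:
for every `α : V` one has `α = ∑ i, n α i • φv i`. -/
def n (α : V) : Fin 4 → ℝ :=
  ![α 1 + α 0, α 1 + α 2 + 2 * α 0, α 1 + α 2 + α 3 + 3 * α 0, 2 * α 0]

/-- The highest root δ = 2φ₁+3φ₂+4φ₃+2φ₄ = e₁+e₂. -/
def δ : V := e 0 + e 1

/-- Compact roots: roots α with n₁(α) even. -/
def Δk : Set V := {α ∈ Δ | ∃ m : ℤ, n α 0 = 2 * m}

/-- Noncompact roots: roots α with n₁(α) odd. -/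
def Δn : Set V := {α ∈ Δ | ∃ m : ℤ, n α 0 = 2 * m + 1}

/-- Δ⁺: roots with all φ-coefficients nonnegative. -/
def Δp : Set V := {α ∈ Δ | ∀ i, 0 ≤ n α i}

def Δkp : Set V := Δp ∩ Δk
def Δnp : Set V := Δp ∩ Δn

/-- A positive system of Δ: the set of roots on which some root-regular linear
functional is positive. -/
def IsPosSystem (P : Set V) : Prop :=
  ∃ f : V →ₗ[ℝ] ℝ, (∀ α ∈ Δ, f α ≠ 0) ∧ P = {α ∈ Δ | 0 < f α}

/-- `le' γ β` means γ ≤ β, i.e. β − γ is a nonnegative integer combination of φ₁,…,φ₄. -/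
def le' (γ β : V) : Prop := ∃ c : Fin 4 → ℕ, β - γ = ∑ i, (c i : ℝ) • φv i

/-- A base of Δ: a linearly independent subset of Δ such that every root is an
integral combination with coefficients all ≥ 0 or all ≤ 0. -/
def IsBase (B : Finset V) : Prop :=
  ↑B ⊆ Δ ∧ LinearIndependent ℝ (Subtype.val : {x : V // x ∈ B} → V) ∧
  ∀ α ∈ Δ, ∃ c : V → ℤ,
    α = ∑ x ∈ B, (c x : ℝ) • x ∧ ((∀ x ∈ B, 0 ≤ c x) ∨ (∀ x ∈ B, c x ≤ 0))

/-- The positive system determined by a base B: roots whose B-coefficients are all ≥ 0. -/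
def posOf (B : Finset V) : Set V :=
  {α ∈ Δ | ∃ c : V → ℤ, α = ∑ x ∈ B, (c x : ℝ) • x ∧ ∀ x ∈ B, 0 ≤ c x}

lemma sum_smul_φv (c : Fin 4 → ℝ) :
    ∑ i, c i • φv i =
      ![c 3 / 2, c 0 - c 3 / 2, c 1 - c 0 - c 3 / 2, c 2 - c 1 - c 3 / 2] := by
  ext j
  fin_cases j <;> simp [Fin.sum_univ_four, φv, φ₁, φ₂, φ₃, φ₄, e] <;> ring

lemma n_sum_smul_φv (c : Fin 4 → ℝ) : n (∑ i, c i • φv i) = c := by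
  rw [sum_smul_φv]
  ext j
  fin_cases j <;> simp [n] <;> ring

lemma sum_n_smul_φv (α : V) : ∑ i, n α i • φv i = α := by
  rw [sum_smul_φv]
  ext j
  fin_cases j <;> simp [n] <;> ring

lemma n_injective : Function.Injective n := fun α β h ↦ by
  rw [← sum_n_smul_φv α, h, sum_n_smul_φv]

lemma n_sub (α β : V) : n (α - β) = n α - n β := by
  ext j
  fin_cases j <;> simp [n] <;> ring

lemma n_neg (α : V) : n (-α) = -n α := by
  ext j
  fin_cases j <;> simp [n] <;> ring

lemma le'_iff {β γ : V} {k l : Fin 4 → ℤ} (hβ : n β = fun i ↦ (k i : ℝ))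
    (hγ : n γ = fun i ↦ (l i : ℝ)) : le' γ β ↔ ∀ i, l i ≤ k i := by
  constructor
  · rintro ⟨c, hc⟩ i
    have h := congrFun (congrArg n hc) i
    rw [n_sum_smul_φv, n_sub, hβ, hγ, Pi.sub_apply] at h
    have h' : k i - l i = (c i : ℤ) := by exact_mod_cast h
    omega
  · intro h
    refine ⟨fun i ↦ (k i - l i).toNat, n_injective ?_⟩
    rw [n_sum_smul_φv, n_sub, hβ, hγ]
    ext i
    have h' : ((k i - l i).toNat : ℤ) = k i - l i := Int.toNat_of_nonneg (sub_nonneg.2 (h i))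
    rw [Pi.sub_apply]
    exact_mod_cast h'.symm

lemma neg_mem_Δ {α : V} (h : α ∈ Δ) : -α ∈ Δ := by
  rcases h with (h | h) | ⟨s, hs, rfl⟩
  · left; left
    simp only [Set.mem_iUnion, Set.mem_insert_iff, Set.mem_singleton_iff] at h ⊢
    obtain ⟨i, rfl | rfl⟩ := h <;> exact ⟨i, by simp⟩
  · left; right
    simp only [Set.mem_iUnion, Set.mem_insert_iff, Set.mem_singleton_iff] at h ⊢
    obtain ⟨i, j, hij, h⟩ := h
    refine ⟨i, j, hij, ?_⟩
    rcases h with rfl | rfl | rfl | rfl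
    · right; right; right; abel
    · right; right; left; abel
    · right; left; abel
    · left; abel
  · right
    refine ⟨-s, fun i ↦ ?_, by simp⟩
    rcases hs i with h | h <;> simp [h]

/-- Twice a root has integral coordinates and squared length 4 or 8. -/
lemma exists_doubled_coords {α : V} (h : α ∈ Δ) :
    ∃ a : Fin 4 → ℤ, (∑ i, a i ^ 2 = 4 ∨ ∑ i, a i ^ 2 = 8) ∧ ∀ i, α i = a i / 2 := by
  rcases h with (h | h) | ⟨s, hs, rfl⟩
  · simp only [Set.mem_iUnion, Set.mem_insert_iff, Set.mem_singleton_iff] at h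
    obtain ⟨i, rfl | rfl⟩ := h
    · refine ⟨Pi.single i 2, ?_, fun j ↦ ?_⟩
      · revert i; decide
      · by_cases hj : j = i <;> simp [e, hj]
    · refine ⟨Pi.single i (-2), ?_, fun j ↦ ?_⟩
      · revert i; decide
      · by_cases hj : j = i <;> simp [e, hj]
  · simp only [Set.mem_iUnion, Set.mem_insert_iff, Set.mem_singleton_iff] at h
    obtain ⟨i, j, hij, h⟩ := h
    have key : ∀ x ∈ ({2, -2} : Finset ℤ), ∀ y ∈ ({2, -2} : Finset ℤ), ∀ i j : Fin 4, i < j →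
        ∑ l, (Pi.single i x + Pi.single j y : Fin 4 → ℤ) l ^ 2 = 8 := by decide
    have key' : ∀ x ∈ ({2, -2} : Finset ℤ), ∀ y ∈ ({2, -2} : Finset ℤ),
        (∀ l, α l = ((Pi.single i x + Pi.single j y : Fin 4 → ℤ) l : ℝ) / 2) →
        ∃ a : Fin 4 → ℤ, (∑ i, a i ^ 2 = 4 ∨ ∑ i, a i ^ 2 = 8) ∧ ∀ i, α i = a i / 2 :=
      fun x hx y hy hl ↦ ⟨_, Or.inr (key x hx y hy i j hij), hl⟩
    rcases h with rfl | rfl | rfl | rfl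
    · refine key' 2 (by simp) 2 (by simp) fun l ↦ ?_
      simp only [e, Pi.add_apply, Pi.single_apply]
      split_ifs <;> norm_num
    · refine key' 2 (by simp) (-2) (by simp) fun l ↦ ?_
      simp only [e, Pi.add_apply, Pi.sub_apply, Pi.single_apply]
      split_ifs <;> norm_num
    · refine key' (-2) (by simp) 2 (by simp) fun l ↦ ?_
      simp only [e, Pi.add_apply, Pi.neg_apply, Pi.single_apply]
      split_ifs <;> norm_num
    · refine key' (-2) (by simp) (-2) (by simp) fun l ↦ ?_
      simp only [e, Pi.add_apply, Pi.sub_apply, Pi.neg_apply, Pi.single_apply]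
      split_ifs <;> norm_num
  · have hs' : ∀ i, ∃ a : ℤ, a ^ 2 = 1 ∧ s i = a := fun i ↦ by
      rcases hs i with h | h
      · exact ⟨1, by simp, by simp [h]⟩
      · exact ⟨-1, by simp, by simp [h]⟩
    choose a ha hsa using hs'
    refine ⟨a, Or.inl (by simp [ha]), fun i ↦ ?_⟩
    fin_cases i <;>
      simp [Fin.sum_univ_four, e, hsa] <;> ring

/-- The `φ`-coordinates of the vectors of squared length 1 or 2 in the root lattice, as read off
from their doubled standard coordinates. -/
def rootCoords : Finset (Fin 4 → ℤ) :=
  ((Finset.Icc (-2 : ℤ) 2 ×ˢ Finset.Icc (-2 : ℤ) 2 ×ˢ Finset.Icc (-2 : ℤ) 2 ×ˢ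
    Finset.Icc (-2 : ℤ) 2).filter fun a ↦
      a.1 ^ 2 + a.2.1 ^ 2 + a.2.2.1 ^ 2 + a.2.2.2 ^ 2 = 4 ∨
      a.1 ^ 2 + a.2.1 ^ 2 + a.2.2.1 ^ 2 + a.2.2.2 ^ 2 = 8).image
    fun a ↦ ![(a.2.1 + a.1) / 2, (a.2.1 + a.2.2.1) / 2 + a.1,
      (a.2.1 + a.2.2.1 + a.2.2.2 + a.1) / 2 + a.1, a.1]

lemma exists_rootCoords {α : V} (h : α ∈ Δ) :
    ∃ k ∈ rootCoords, n α = fun i ↦ (k i : ℝ) := by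
  obtain ⟨a, ha, hα⟩ := exists_doubled_coords h
  simp only [Fin.sum_univ_four] at ha
  have hle : ∀ x y z w : ℤ, (x ^ 2 + y ^ 2 + z ^ 2 + w ^ 2 = 4 ∨
      x ^ 2 + y ^ 2 + z ^ 2 + w ^ 2 = 8) → x ∈ Finset.Icc (-2 : ℤ) 2 := by
    intro x y z w hx
    have : x ^ 2 ≤ 8 := by
      rcases hx with hx | hx <;> linarith [sq_nonneg y, sq_nonneg z, sq_nonneg w]
    rw [Finset.mem_Icc]
    constructor <;> nlinarith
  have h0 := hle (a 0) (a 1) (a 2) (a 3) ha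
  have h1 := hle (a 1) (a 0) (a 2) (a 3) (by convert ha using 2 <;> ring)
  have h2 := hle (a 2) (a 0) (a 1) (a 3) (by convert ha using 2 <;> ring)
  have h3 := hle (a 3) (a 0) (a 1) (a 2) (by convert ha using 2 <;> ring)
  have parity : ∀ x ∈ Finset.Icc (-2 : ℤ) 2, ∀ y ∈ Finset.Icc (-2 : ℤ) 2,
      ∀ z ∈ Finset.Icc (-2 : ℤ) 2, ∀ w ∈ Finset.Icc (-2 : ℤ) 2,
      (x ^ 2 + y ^ 2 + z ^ 2 + w ^ 2 = 4 ∨ x ^ 2 + y ^ 2 + z ^ 2 + w ^ 2 = 8) →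
      2 ∣ y + x ∧ 2 ∣ y + z ∧ 2 ∣ y + z + w + x := by
    decide +kernel
  obtain ⟨p, q, r⟩ := parity _ h0 _ h1 _ h2 _ h3 ha
  refine ⟨_, Finset.mem_image.2 ⟨(a 0, a 1, a 2, a 3),
    Finset.mem_filter.2 ⟨by simp only [Finset.mem_product]; exact ⟨h0, h1, h2, h3⟩, ha⟩, rfl⟩, ?_⟩
  ext i
  fin_cases i
  · simp [n, hα, Int.cast_div p]; ring
  · simp [n, hα, Int.cast_div q]; ring
  · simp [n, hα, Int.cast_div r]; ring
  · simp [n, hα]; ring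

/-- The new simple roots `φ₁+2φ₂+2φ₃`, `φ₁+φ₂+2φ₃+2φ₄`, `-(φ₁+φ₂+2φ₃+φ₄)`, `φ₃`. -/
def simpleRoot : Fin 4 → V :=
  ![φ₁ + (2 : ℝ) • φ₂ + (2 : ℝ) • φ₃, φ₁ + φ₂ + (2 : ℝ) • φ₃ + (2 : ℝ) • φ₄,
    -(φ₁ + φ₂ + (2 : ℝ) • φ₃ + φ₄), φ₃]

/-- The coordinates with respect to `simpleRoot` in terms of the `φ`-coordinates. -/
def simpleCoords {R : Type*} [CommRing R] (k : Fin 4 → R) : Fin 4 → R :=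
  ![k 1 - k 0, k 3 + k 1 - 2 * k 0, k 3 + 2 * k 1 - 4 * k 0, k 2 - 2 * k 0]

lemma n_sum_smul_simpleRoot (c : Fin 4 → ℝ) :
    n (∑ i, c i • simpleRoot i) = ![c 0 + c 1 - c 2, 2 * c 0 + c 1 - c 2,
      2 * c 0 + 2 * c 1 - 2 * c 2 + c 3, 2 * c 1 - c 2] := by
  ext j
  fin_cases j <;>
    simp [Fin.sum_univ_four, n, simpleRoot, φ₁, φ₂, φ₃, φ₄, e] <;> ring

lemma simpleCoords_n_sum (c : Fin 4 → ℝ) :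
    simpleCoords (n (∑ i, c i • simpleRoot i)) = c := by
  rw [n_sum_smul_simpleRoot]
  ext j
  fin_cases j <;> simp [simpleCoords] <;> ring

lemma sum_simpleCoords (α : V) : ∑ i, simpleCoords (n α) i • simpleRoot i = α := by
  apply n_injective
  rw [n_sum_smul_simpleRoot]
  ext j
  fin_cases j <;> simp [simpleCoords] <;> ring

lemma simpleCoords_intCast (k : Fin 4 → ℤ) :
    simpleCoords (fun i ↦ (k i : ℝ)) = fun i ↦ ((simpleCoords k i : ℤ) : ℝ) := by
  ext j
  fin_cases j <;> simp [simpleCoords]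

lemma linearIndependent_simpleRoot : LinearIndependent ℝ simpleRoot := by
  rw [Fintype.linearIndependent_iff]
  intro g hg i
  rw [← simpleCoords_n_sum g, hg]
  fin_cases i <;> simp [simpleCoords, n]

lemma simpleRoot_mem_Δ (i : Fin 4) : simpleRoot i ∈ Δ := by
  fin_cases i
  · refine Or.inl (Or.inr ?_)
    simp only [Set.mem_iUnion, Set.mem_insert_iff]
    refine ⟨1, 2, by decide, Or.inl ?_⟩
    ext j
    fin_cases j <;> simp [simpleRoot, φ₁, φ₂, φ₃, e]
    norm_num
  · refine Or.inl (Or.inr ?_)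
    simp only [Set.mem_iUnion, Set.mem_insert_iff]
    refine ⟨0, 2, by decide, Or.inr (Or.inl ?_)⟩
    ext j
    fin_cases j <;> simp [simpleRoot, φ₁, φ₂, φ₃, φ₄, e]
    norm_num
  · refine Or.inr ⟨![-1, -1, 1, -1], fun j ↦ ?_, ?_⟩
    · fin_cases j <;> simp
    · ext j
      fin_cases j <;>
        simp [Fin.sum_univ_four, simpleRoot, φ₁, φ₂, φ₃, φ₄, e] <;> norm_num
  · refine Or.inl (Or.inl ?_)
    simp only [Set.mem_iUnion, Set.mem_insert_iff]
    exact ⟨3, Or.inl rfl⟩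

lemma image_simpleRoot :
    ({φ₁ + (2 : ℝ) • φ₂ + (2 : ℝ) • φ₃, φ₁ + φ₂ + (2 : ℝ) • φ₃ + (2 : ℝ) • φ₄,
      -(φ₁ + φ₂ + (2 : ℝ) • φ₃ + φ₄), φ₃} : Finset V) = Finset.univ.image simpleRoot := by
  ext x
  simp [Fin.exists_fin_succ, simpleRoot, eq_comm]

lemma exists_coeff_iff {b : Fin 4 → V} (hb : Function.Injective b) {α : V}
    (p : (Fin 4 → ℤ) → Prop) :
    (∃ c : V → ℤ, α = ∑ x ∈ Finset.univ.image b, (c x : ℝ) • x ∧ p (c ∘ b)) ↔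
      ∃ c : Fin 4 → ℤ, α = ∑ i, (c i : ℝ) • b i ∧ p c := by
  simp only [Finset.sum_image hb.injOn]
  constructor
  · rintro ⟨c, h⟩
    exact ⟨c ∘ b, h⟩
  · rintro ⟨c, h, hp⟩
    refine ⟨Function.extend b c 0, ?_, ?_⟩
    · simpa [hb.extend_apply] using h
    · rwa [Function.extend_comp hb]

lemma exists_simpleCoords_iff {α : V} {k : Fin 4 → ℤ} (hk : n α = fun i ↦ (k i : ℝ))
    (p : (Fin 4 → ℤ) → Prop) :
    (∃ c : V → ℤ, α = ∑ x ∈ Finset.univ.image simpleRoot, (c x : ℝ) • x ∧ p (c ∘ simpleRoot)) ↔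
      p (simpleCoords k) := by
  rw [exists_coeff_iff linearIndependent_simpleRoot.injective]
  constructor
  · rintro ⟨c, h, hp⟩
    have h' := simpleCoords_n_sum fun i ↦ (c i : ℝ)
    rw [← h, hk, simpleCoords_intCast] at h'
    have : simpleCoords k = c := by
      ext i
      exact_mod_cast congrFun h' i
    rwa [this]
  · intro hp
    refine ⟨_, ?_, hp⟩
    have h := sum_simpleCoords α
    rw [hk, simpleCoords_intCast] at h
    exact h.symm

lemma simpleCoords_nonneg_or_nonpos : ∀ k ∈ rootCoords,
    (∀ i, 0 ≤ simpleCoords k i) ∨ (∀ i, simpleCoords k i ≤ 0) := by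
  decide +kernel

lemma simpleCoords_nonneg_iff : ∀ k ∈ rootCoords,
    (∀ i, 0 ≤ simpleCoords k i) ↔
      (((∀ i, 0 ≤ k i) ∧ Even (k 0)) ∨
        ((∀ i, 0 ≤ k i) ∧ Odd (k 0)) ∧
          ((∀ i, ![1, 2, 2, 0] i ≤ k i) ∨ (∀ i, ![1, 1, 2, 2] i ≤ k i))) ∨
      ((∀ i, 0 ≤ (-k) i) ∧ Odd ((-k) 0)) ∧ ∀ i, (-k) i ≤ ![1, 1, 2, 1] i := by
  decide +kernel

lemma mem_Δkp_iff {α : V} {k : Fin 4 → ℤ} (hα : α ∈ Δ) (hk : n α = fun i ↦ (k i : ℝ)) :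
    α ∈ Δkp ↔ (∀ i, 0 ≤ k i) ∧ Even (k 0) := by
  simp only [Δkp, Δp, Δk, Set.mem_inter_iff, Set.mem_ofPred_eq, hα, hk, true_and,
    even_iff_exists_two_mul]
  norm_cast

lemma mem_Δnp_iff {α : V} {k : Fin 4 → ℤ} (hα : α ∈ Δ) (hk : n α = fun i ↦ (k i : ℝ)) :
    α ∈ Δnp ↔ (∀ i, 0 ≤ k i) ∧ Odd (k 0) := by
  simp only [Δnp, Δp, Δn, Set.mem_inter_iff, Set.mem_ofPred_eq, hα, hk, true_and, Odd]
  norm_cast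

lemma isBase_simpleRoot : IsBase (Finset.univ.image simpleRoot) := by
  refine ⟨?_, ?_, fun α hα ↦ ?_⟩
  · simpa [Set.range_subset_iff] using simpleRoot_mem_Δ
  · have h := linearIndependent_simpleRoot.linearIndepOn_id
    rw [← Set.image_univ, ← Finset.coe_univ, ← Finset.coe_image] at h
    exact h
  · obtain ⟨k, hk, hαk⟩ := exists_rootCoords hα
    have h := (exists_simpleCoords_iff hαk fun c ↦ (∀ i, 0 ≤ c i) ∨ ∀ i, c i ≤ 0).2
      (simpleCoords_nonneg_or_nonpos k hk)
    simpa using h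

lemma posOf_simpleRoot : posOf (Finset.univ.image simpleRoot) =
    Δkp ∪ {β ∈ Δnp | le' (φ₁ + (2 : ℝ) • φ₂ + (2 : ℝ) • φ₃) β ∨
      le' (φ₁ + φ₂ + (2 : ℝ) • φ₃ + (2 : ℝ) • φ₄) β} ∪
      (Neg.neg '' {β ∈ Δnp | le' β (φ₁ + φ₂ + (2 : ℝ) • φ₃ + φ₄)}) := by
  ext α
  by_cases hα : α ∈ Δ
  · obtain ⟨k, hk, hαk⟩ := exists_rootCoords hα
    have hnegk : n (-α) = fun i ↦ ((-k) i : ℝ) := by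
      rw [n_neg, hαk]
      ext i
      simp
    have h1 : n (φ₁ + (2 : ℝ) • φ₂ + (2 : ℝ) • φ₃) = fun i ↦ ((![1, 2, 2, 0] i : ℤ) : ℝ) := by
      ext j
      fin_cases j <;> simp [n, φ₁, φ₂, φ₃, e]
    have h2 : n (φ₁ + φ₂ + (2 : ℝ) • φ₃ + (2 : ℝ) • φ₄) =
        fun i ↦ ((![1, 1, 2, 2] i : ℤ) : ℝ) := by
      ext j
      fin_cases j <;> simp [n, φ₁, φ₂, φ₃, φ₄, e] <;> norm_num
    have h3 : n (φ₁ + φ₂ + (2 : ℝ) • φ₃ + φ₄) = fun i ↦ ((![1, 1, 2, 1] i : ℤ) : ℝ) := by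
      ext j
      fin_cases j <;> simp [n, φ₁, φ₂, φ₃, φ₄, e] <;> norm_num
    have hpos : α ∈ posOf (Finset.univ.image simpleRoot) ↔ ∀ i, 0 ≤ simpleCoords k i := by
      rw [← exists_simpleCoords_iff hαk fun c ↦ ∀ i, 0 ≤ c i]
      simp [posOf, hα]
    have hneg (S : Set V) : α ∈ Neg.neg '' S ↔ -α ∈ S := by simp
    rw [hpos, simpleCoords_nonneg_iff k hk, Set.mem_union, Set.mem_union, hneg, Set.mem_ofPred_eq,
      Set.mem_ofPred_eq, mem_Δkp_iff hα hαk, mem_Δnp_iff hα hαk, mem_Δnp_iff (neg_mem_Δ hα) hnegk,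
      le'_iff hαk h1, le'_iff hαk h2, le'_iff h3 hnegk]
  · refine iff_of_false (fun h ↦ hα h.1) ?_
    rintro ((h | h) | ⟨β, h, rfl⟩)
    · exact hα h.1.1
    · exact hα h.1.1.1
    · exact hα (neg_mem_Δ h.1.1.1)

theorem stmt13 :
    IsBase ({φ₁ + (2 : ℝ) • φ₂ + (2 : ℝ) • φ₃, φ₁ + φ₂ + (2 : ℝ) • φ₃ + (2 : ℝ) • φ₄, -(φ₁ + φ₂ + (2 : ℝ) • φ₃ + φ₄), φ₃} : Finset V) ∧
    posOf ({φ₁ + (2 : ℝ) • φ₂ + (2 : ℝ) • φ₃, φ₁ + φ₂ + (2 : ℝ) • φ₃ + (2 : ℝ) • φ₄, -(φ₁ + φ₂ + (2 : ℝ) • φ₃ + φ₄), φ₃} : Finset V) =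
      Δkp ∪ {β ∈ Δnp | le' (φ₁ + (2 : ℝ) • φ₂ + (2 : ℝ) • φ₃) β ∨ le' (φ₁ + φ₂ + (2 : ℝ) • φ₃ + (2 : ℝ) • φ₄) β} ∪ (Neg.neg '' {β ∈ Δnp | le' β (φ₁ + φ₂ + (2 : ℝ) • φ₃ + φ₄)}) ∧
    Δkp ⊆ posOf ({φ₁ + (2 : ℝ) • φ₂ + (2 : ℝ) • φ₃, φ₁ + φ₂ + (2 : ℝ) • φ₃ + (2 : ℝ) • φ₄, -(φ₁ + φ₂ + (2 : ℝ) • φ₃ + φ₄), φ₃} : Finset V) := by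
  rw [image_simpleRoot, posOf_simpleRoot]
  exact ⟨isBase_simpleRoot, rfl, fun _ h ↦ Or.inl (Or.inl h)⟩
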